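/- Let N ≥ 3, μ < μ₀ = (N-2)²/4, γ ∈ (0,1), and let f ≥ 0 be a function in C^γ_loc(ℝ^N∖{0}) with ∫_K f(x)|x|^{τ₊(μ)} dx < +∞ for every compact K ⊂ ℝ^N. Suppose u_k is a nonnegative classical solution of -Δu - μ|x|^{-2}u = f in ℝ^N∖{0} with lim_{|x|→+∞} u_k(x) = 0, satisfying ∫_{ℝ^N} u_k(x) L*_μξ(x) |x|^{τ₊(μ)} dx = ∫_{ℝ^N} f(x) ξ(x) |x|^{τ₊(μ)} dx + c_μ k ξ(0) for every compactly supported C^{1,1} function ξ on ℝ^N, for some k ≥ 0. Then u_k(x) ≥ k|x|^{τ₋(μ)} for all x ∈ ℝ^N∖{0}. -/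

import Mathlib

open Filter MeasureTheory Metric

noncomputable section

/-- Euclidean space ℝ^N. -/
abbrev Euc (N : ℕ) : Type := EuclideanSpace ℝ (Fin N)

/-- The Laplacian of `u` at `x`, as the sum of the pure second derivatives in the
coordinate directions. -/
def lap {N : ℕ} (u : Euc N → ℝ) (x : Euc N) : ℝ :=
  ∑ i : Fin N, fderiv ℝ (fun y => fderiv ℝ u y (EuclideanSpace.single i 1)) x
    (EuclideanSpace.single i 1)

/-- μ₀ = (N-2)²/4. -/
def mu0 (N : ℕ) : ℝ := ((N : ℝ) - 2) ^ 2 / 4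

/-- τ₋(μ) = -(N-2)/2 - √(μ₀-μ). -/
def tauMinus (N : ℕ) (μ : ℝ) : ℝ := -((N : ℝ) - 2) / 2 - Real.sqrt (mu0 N - μ)

/-- τ₊(μ) = -(N-2)/2 + √(μ₀-μ). -/
def tauPlus (N : ℕ) (μ : ℝ) : ℝ := -((N : ℝ) - 2) / 2 + Real.sqrt (mu0 N - μ)

/-- Surface area of the unit sphere in ℝ^N, i.e. N times the volume of the unit ball. -/
def sphereArea (N : ℕ) : ℝ := N * (volume (ball (0 : Euc N) 1)).toReal

/-- The normalizing constant c_μ: 2√(μ₀-μ)|𝕊^{N-1}| for μ < μ₀ and |𝕊^{N-1}| for μ = μ₀. -/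
def cMu (N : ℕ) (μ : ℝ) : ℝ :=
  if μ < mu0 N then 2 * Real.sqrt (mu0 N - μ) * sphereArea N else sphereArea N

/-- The normalizing constant c_N = ((N-2)|𝕊^{N-1}|)⁻¹ of the fundamental solution of -Δ. -/
def cN (N : ℕ) : ℝ := (((N : ℝ) - 2) * sphereArea N)⁻¹

/-- The singular profile Φ_μ: |x|^{τ₋(μ)} for μ < μ₀ and |x|^{-(N-2)/2}(-ln|x|) for μ = μ₀. -/
def PhiFun (N : ℕ) (μ : ℝ) (x : Euc N) : ℝ :=
  if μ < mu0 N then ‖x‖ ^ tauMinus N μ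
  else ‖x‖ ^ (-((N : ℝ) - 2) / 2) * (-Real.log ‖x‖)

/-- The adjoint operator L*_μ ξ(x) = -Δξ(x) - 2τ₊(μ)|x|⁻² x·∇ξ(x). -/
def LstarMu (N : ℕ) (μ : ℝ) (ξ : Euc N → ℝ) (x : Euc N) : ℝ :=
  -lap ξ x - 2 * tauPlus N μ / ‖x‖ ^ 2 * fderiv ℝ ξ x x

/-- The adjoint operator L*_{μV} ξ = L*_μ ξ - μ(V - |x|⁻²)ξ. -/
def LstarMuV (N : ℕ) (μ : ℝ) (V ξ : Euc N → ℝ) (x : Euc N) : ℝ :=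
  LstarMu N μ ξ x - μ * (V x - ‖x‖ ^ (-2 : ℝ)) * ξ x

/-- A compactly supported C^{1,1} test function: compactly supported, differentiable,
with Lipschitz gradient. -/
def IsC11c {N : ℕ} (ξ : Euc N → ℝ) : Prop :=
  HasCompactSupport ξ ∧ Differentiable ℝ ξ ∧ ∃ L : NNReal, LipschitzWith L (fderiv ℝ ξ)

/-- The dμ-distributional identity with constant `k`. -/
def DistribIdentity (N : ℕ) (μ : ℝ) (V u : Euc N → ℝ) (k : ℝ) : Prop :=
  ∀ ξ : Euc N → ℝ, IsC11c ξ →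
    ∫ x : Euc N, u x * LstarMuV N μ V ξ x * ‖x‖ ^ tauPlus N μ = cMu N μ * k * ξ 0

/-- `u` is a classical solution of -Δu - μVu = 0 in ℝ^N∖{0}. -/
def IsSolution (N : ℕ) (μ : ℝ) (V u : Euc N → ℝ) : Prop :=
  ContDiffOn ℝ 2 u {x : Euc N | x ≠ 0} ∧
  ∀ x : Euc N, x ≠ 0 → -lap u x - μ * V x * u x = 0

/-- `f` is locally γ-Hölder continuous on `s`. -/
def LocHolderOn {N : ℕ} (γ : ℝ) (s : Set (Euc N)) (f : Euc N → ℝ) : Prop :=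
  ∀ x ∈ s, ∃ ε > 0, ∃ C > 0, ∀ y ∈ ball x ε ∩ s, ∀ z ∈ ball x ε ∩ s,
    |f y - f z| ≤ C * dist y z ^ γ

/-- The filter `‖x‖ → +∞` on ℝ^N. -/
def normAtTop (N : ℕ) : Filter (Euc N) := comap norm atTop

/-- Assumption (V): V is locally Hölder and positive on ℝ^N∖{0},
0 ≤ V(x) - |x|⁻² ≤ c₀, and limsup_{|x|→∞} V(x)|x|² = α. -/
def AssumpV (N : ℕ) (V : Euc N → ℝ) (α : ℝ) : Prop :=
  (∃ γ : ℝ, 0 < γ ∧ γ < 1 ∧ LocHolderOn γ {x : Euc N | x ≠ 0} V) ∧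
  (∀ x : Euc N, x ≠ 0 → 0 < V x) ∧
  (∃ c₀ : ℝ, 0 < c₀ ∧ ∀ x : Euc N, x ≠ 0 →
    0 ≤ V x - ‖x‖ ^ (-2 : ℝ) ∧ V x - ‖x‖ ^ (-2 : ℝ) ≤ c₀) ∧
  limsup (fun x : Euc N => V x * ‖x‖ ^ 2) (normAtTop N) = α

/-- Assumption (Ṽ): V is locally Hölder and positive on ℝ^N∖{0},
0 ≤ V(x) - |x|⁻² ≤ c₀, and liminf_{|x|→∞} V(x)|x|² = β. -/
def AssumpVtilde (N : ℕ) (V : Euc N → ℝ) (β : ℝ) : Prop :=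
  (∃ γ : ℝ, 0 < γ ∧ γ < 1 ∧ LocHolderOn γ {x : Euc N | x ≠ 0} V) ∧
  (∀ x : Euc N, x ≠ 0 → 0 < V x) ∧
  (∃ c₀ : ℝ, 0 < c₀ ∧ ∀ x : Euc N, x ≠ 0 →
    0 ≤ V x - ‖x‖ ^ (-2 : ℝ) ∧ V x - ‖x‖ ^ (-2 : ℝ) ≤ c₀) ∧
  liminf (fun x : Euc N => V x * ‖x‖ ^ 2) (normAtTop N) = β

/-- The potential V_ρ(x) = |x|⁻²(1 + ρ|x|²)/(1 + |x|²). -/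
def Vrho (N : ℕ) (ρ : ℝ) (x : Euc N) : ℝ :=
  ‖x‖ ^ (-2 : ℝ) * (1 + ρ * ‖x‖ ^ 2) / (1 + ‖x‖ ^ 2)

/-- Ω has C² boundary: it is the sublevel set of a C² function whose differential
does not vanish on the boundary. -/
def HasC2Boundary {N : ℕ} (Ω : Set (Euc N)) : Prop :=
  ∃ φ : Euc N → ℝ, ContDiff ℝ 2 φ ∧ Ω = {x | φ x < 0} ∧
    ∀ x ∈ frontier Ω, fderiv ℝ φ x ≠ 0

theorem fderiv_radial_apply {N : ℕ} {θ : ℝ → ℝ} {θ' : ℝ} {x : Euc N}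
    (h : HasDerivAt θ θ' (‖x‖ ^ 2)) (v : Euc N) :
    fderiv ℝ (fun y : Euc N => θ (‖y‖ ^ 2)) x v = 2 * θ' * inner ℝ x v := by
  have h1 := h.comp_hasFDerivAt x (hasStrictFDerivAt_norm_sq x).hasFDerivAt
  have h2 : (fun y : Euc N => θ (‖y‖ ^ 2)) = θ ∘ fun y : Euc N => ‖y‖ ^ 2 := rfl
  rw [h2, h1.fderiv]
  simp
  ring

theorem lap_radial {N : ℕ} {θ θ₁ : ℝ → ℝ} {θ₂ : ℝ} {x : Euc N}
    (h₁ : ∀ᶠ t in nhds (‖x‖ ^ 2), HasDerivAt θ (θ₁ t) t)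
    (h₂ : HasDerivAt θ₁ θ₂ (‖x‖ ^ 2)) :
    lap (fun y : Euc N => θ (‖y‖ ^ 2)) x = 4 * ‖x‖ ^ 2 * θ₂ + 2 * N * θ₁ (‖x‖ ^ 2) := by
  have hc : ContinuousAt (fun y : Euc N => ‖y‖ ^ 2) x := by fun_prop
  have key : ∀ i : Fin N,
      fderiv ℝ (fun y => fderiv ℝ (fun y : Euc N => θ (‖y‖ ^ 2)) y (EuclideanSpace.single i 1)) x
        (EuclideanSpace.single i 1) = 4 * θ₂ * x i ^ 2 + 2 * θ₁ (‖x‖ ^ 2) := by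
    intro i
    have he : (fun y => fderiv ℝ (fun y : Euc N => θ (‖y‖ ^ 2)) y (EuclideanSpace.single i 1))
        =ᶠ[nhds x] fun y => 2 * (θ₁ (‖y‖ ^ 2) * y i) := by
      filter_upwards [hc.eventually h₁] with y hy
      rw [fderiv_radial_apply hy]
      simp [EuclideanSpace.inner_single_right]
      ring
    rw [he.fderiv_eq]
    have hp : HasFDerivAt (fun y : Euc N => y i) (EuclideanSpace.proj i : Euc N →L[ℝ] ℝ) x :=
      (EuclideanSpace.proj i : Euc N →L[ℝ] ℝ).hasFDerivAt
    have h3 := ((h₂.comp_hasFDerivAt x (hasStrictFDerivAt_norm_sq x).hasFDerivAt).mul hp).const_mul 2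
    have h4 := h3.fderiv
    refine (congrArg (fun T => T (EuclideanSpace.single i 1)) h4).trans ?_
    simp [EuclideanSpace.inner_single_right]
    ring
  unfold lap
  rw [Finset.sum_congr rfl fun i _ => key i, Finset.sum_add_distrib, ← Finset.mul_sum,
    EuclideanSpace.norm_sq_eq]
  simp
  ring

theorem lap_norm_rpow {N : ℕ} (p : ℝ) {x : Euc N} (hx : x ≠ 0) :
    lap (fun y : Euc N => ‖y‖ ^ p) x = p * (p + N - 2) * ‖x‖ ^ (-2 : ℝ) * ‖x‖ ^ p := by
  have hpos : 0 < ‖x‖ := norm_pos_iff.2 hx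
  have hfun : (fun y : Euc N => ‖y‖ ^ p) = fun y : Euc N => (fun t : ℝ => t ^ (p / 2)) (‖y‖ ^ 2) := by
    funext y
    simp only
    rw [← Real.rpow_natCast, ← Real.rpow_mul (norm_nonneg y)]
    congr 1
    push_cast
    ring
  rw [hfun, lap_radial (θ := fun t : ℝ => t ^ (p / 2)) (θ₁ := fun t => p / 2 * t ^ (p / 2 - 1))
    (θ₂ := p / 2 * ((p / 2 - 1) * (‖x‖ ^ 2) ^ (p / 2 - 1 - 1)))]
  · have h1 : (‖x‖ ^ 2) ^ (p / 2 - 1) = ‖x‖ ^ (-2 : ℝ) * ‖x‖ ^ p := by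
      rw [← Real.rpow_natCast, ← Real.rpow_mul hpos.le, ← Real.rpow_add hpos]
      congr 1; push_cast; ring
    have h2 : ‖x‖ ^ 2 * (‖x‖ ^ 2) ^ (p / 2 - 1 - 1) = ‖x‖ ^ (-2 : ℝ) * ‖x‖ ^ p := by
      rw [← h1, Real.rpow_sub_one (by positivity) (p / 2 - 1)]
      field_simp
    have h3 : (fun t : ℝ => t ^ (p / 2)) (‖x‖ ^ 2) = ‖x‖ ^ p := (congrFun hfun x).symm
    simp only [h1]
    linear_combination (2 * p * (p / 2 - 1)) * h2
  · filter_upwards [lt_mem_nhds (by positivity : 0 < ‖x‖ ^ 2)] with t ht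
    exact Real.hasDerivAt_rpow_const (Or.inl (ne_of_gt ht))
  · exact (Real.hasDerivAt_rpow_const (Or.inl (by positivity))).const_mul _

theorem lap_comp_smul {N : ℕ} (u : Euc N → ℝ) (r : ℝ) (x : Euc N) :
    lap (fun y => u (r • y)) x = r ^ 2 * lap u (r • x) := by
  unfold lap
  rw [Finset.mul_sum]
  refine Finset.sum_congr rfl fun i _ => ?_
  have h : (fun y => fderiv ℝ (fun y => u (r • y)) y (EuclideanSpace.single i 1)) =
      fun y => r • (fun z => fderiv ℝ u z (EuclideanSpace.single i 1)) (r • y) := by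
    funext y
    rw [fderiv_comp_smul]
    rfl
  have h' := congrFun (fderiv_const_smul_field (𝕜 := ℝ)
    (f := fun y => (fun z => fderiv ℝ u z (EuclideanSpace.single i 1)) (r • y)) r) x
  rw [h]
  refine (congrArg (fun T => T (EuclideanSpace.single i 1)) h').trans ?_
  rw [Pi.smul_apply,
    fderiv_comp_smul (f := fun z => fderiv ℝ u z (EuclideanSpace.single i 1))]
  simp
  ring

theorem Filter.EventuallyEq.lap_eq {N : ℕ} {u v : Euc N → ℝ} {x : Euc N} (h : u =ᶠ[nhds x] v) :
    lap u x = lap v x := by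
  unfold lap
  refine Finset.sum_congr rfl fun i _ => ?_
  have : (fun y => fderiv ℝ u y (EuclideanSpace.single i 1)) =ᶠ[nhds x]
      fun y => fderiv ℝ v y (EuclideanSpace.single i 1) := by
    filter_upwards [h.eventuallyEq_nhds] with y hy
    rw [hy.fderiv_eq]
  rw [this.fderiv_eq]

theorem lap_sub_const_mul {N : ℕ} {u v : Euc N → ℝ} {x : Euc N} (a : ℝ)
    (hu : ContDiffAt ℝ 2 u x) (hv : ContDiffAt ℝ 2 v x) :
    lap (fun y => u y - a * v y) x = lap u x - a * lap v x := by
  unfold lap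
  rw [Finset.mul_sum, ← Finset.sum_sub_distrib]
  refine Finset.sum_congr rfl fun i _ => ?_
  have hd : ∀ {w : Euc N → ℝ}, ContDiffAt ℝ 2 w x →
      DifferentiableAt ℝ (fun y => fderiv ℝ w y (EuclideanSpace.single i 1)) x := fun hw =>
    ((hw.fderiv_right (m := 1) (by norm_num)).differentiableAt (by norm_num)).clm_apply
      (differentiableAt_const _)
  have he : (fun y => fderiv ℝ (fun y => u y - a * v y) y (EuclideanSpace.single i 1)) =ᶠ[nhds x]
      fun y => fderiv ℝ u y (EuclideanSpace.single i 1)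
        - a * fderiv ℝ v y (EuclideanSpace.single i 1) := by
    filter_upwards [hu.eventually (by simp), hv.eventually (by simp)] with y hy hy'
    have h1 := hy.differentiableAt (by norm_num)
    have h2 := hy'.differentiableAt (by norm_num)
    rw [fderiv_fun_sub h1 (h2.const_mul a), fderiv_const_mul h2]
    simp
  rw [he.fderiv_eq, fderiv_fun_sub (hd hu) ((hd hv).const_mul a), fderiv_const_mul (hd hv)]
  simp

theorem hasDerivAt_max_zero_pow_three (t : ℝ) :
    HasDerivAt (fun t : ℝ => max t 0 ^ 3) (3 * max t 0 ^ 2) t := by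
  have h := ((hasDerivAt_id t).pow 3).add (hasDerivAt_abs_rpow t (p := 3) (by norm_num))
  have he : (fun t : ℝ => max t 0 ^ 3) = fun t => (t ^ 3 + |t| ^ (3 : ℝ)) / 2 := by
    funext t
    rw [show (3 : ℝ) = (3 : ℕ) by norm_num, Real.rpow_natCast]
    rcases le_total t 0 with ht | ht
    · rw [max_eq_right ht, abs_of_nonpos ht]
      ring
    · rw [max_eq_left ht, abs_of_nonneg ht]
      ring
  rw [he]
  refine (h.div_const 2).congr_deriv ?_
  norm_num
  rcases le_total t 0 with ht | ht
  · rw [max_eq_right ht, abs_of_nonpos ht]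
    ring
  · rw [max_eq_left ht, abs_of_nonneg ht]
    ring

/-- The potential of the averaging kernel `avgKernel`: `∇ avgPotential y = -avgKernel y • y`. -/
def avgPotential {N : ℕ} (y : Euc N) : ℝ := max (1 - ‖y‖ ^ 2) 0 ^ 3

/-- A radial kernel supported in the closed unit ball. -/
def avgKernel {N : ℕ} (y : Euc N) : ℝ := 6 * max (1 - ‖y‖ ^ 2) 0 ^ 2

theorem continuous_avgKernel {N : ℕ} : Continuous (avgKernel : Euc N → ℝ) := by
  unfold avgKernel; fun_prop

theorem continuous_avgPotential {N : ℕ} : Continuous (avgPotential : Euc N → ℝ) := by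
  unfold avgPotential; fun_prop

theorem avgKernel_nonneg {N : ℕ} (y : Euc N) : 0 ≤ avgKernel y := by
  unfold avgKernel; positivity

theorem avgPotential_nonneg {N : ℕ} (y : Euc N) : 0 ≤ avgPotential y := by
  unfold avgPotential; positivity

theorem avgPotential_le_avgKernel {N : ℕ} (y : Euc N) : avgPotential y ≤ avgKernel y := by
  unfold avgPotential avgKernel
  have h0 : 0 ≤ max (1 - ‖y‖ ^ 2) 0 := le_max_right _ _
  have h1 : max (1 - ‖y‖ ^ 2) 0 ≤ 1 := max_le (by nlinarith [norm_nonneg y]) zero_le_one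
  nlinarith [sq_nonneg (max (1 - ‖y‖ ^ 2) 0),
    mul_nonneg (sq_nonneg (max (1 - ‖y‖ ^ 2) 0)) (sub_nonneg.2 h1)]

theorem max_one_sub_norm_sq_eq_zero {N : ℕ} {y : Euc N} (hy : y ∉ closedBall (0 : Euc N) 1) :
    max (1 - ‖y‖ ^ 2) 0 = 0 := by
  rw [mem_closedBall_zero_iff, not_le] at hy
  exact max_eq_right (by nlinarith)

theorem avgKernel_eq_zero {N : ℕ} {y : Euc N} (hy : y ∉ closedBall (0 : Euc N) 1) :
    avgKernel y = 0 := by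
  simp [avgKernel, max_one_sub_norm_sq_eq_zero hy]

theorem avgPotential_eq_zero {N : ℕ} {y : Euc N} (hy : y ∉ closedBall (0 : Euc N) 1) :
    avgPotential y = 0 := by
  simp [avgPotential, max_one_sub_norm_sq_eq_zero hy]

theorem hasCompactSupport_avgKernel {N : ℕ} : HasCompactSupport (avgKernel : Euc N → ℝ) :=
  HasCompactSupport.intro (isCompact_closedBall 0 1) fun _ => avgKernel_eq_zero

theorem hasCompactSupport_avgPotential {N : ℕ} : HasCompactSupport (avgPotential : Euc N → ℝ) :=
  HasCompactSupport.intro (isCompact_closedBall 0 1) fun _ => avgPotential_eq_zero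

theorem fderiv_avgPotential_apply {N : ℕ} (y v : Euc N) :
    fderiv ℝ avgPotential y v = -(avgKernel y * inner ℝ y v) := by
  have h : HasDerivAt (fun t : ℝ => max (1 - t) 0 ^ 3) (3 * max (1 - ‖y‖ ^ 2) 0 ^ 2 * (-1))
      (‖y‖ ^ 2) := by
    exact (hasDerivAt_max_zero_pow_three (1 - ‖y‖ ^ 2)).comp (‖y‖ ^ 2)
      ((hasDerivAt_id (‖y‖ ^ 2)).const_sub 1)
  refine (fderiv_radial_apply h v).trans ?_
  unfold avgKernel
  ring

theorem differentiable_avgPotential {N : ℕ} : Differentiable ℝ (avgPotential : Euc N → ℝ) := by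
  intro y
  have h : DifferentiableAt ℝ (fun t : ℝ => max t 0 ^ 3) (1 - ‖y‖ ^ 2) :=
    (hasDerivAt_max_zero_pow_three _).differentiableAt
  exact h.comp y ((contDiff_norm_sq ℝ (n := 1)).differentiable (by norm_num) y |>.const_sub 1)

/-- The derivative of a kernel average in the radius is a kernel average of the Laplacian. -/
theorem hasDerivAt_integral_avgKernel {N : ℕ} {g : Euc N → ℝ} (hg : ContDiff ℝ 2 g) (x : Euc N)
    (s : ℝ) :
    HasDerivAt (fun s : ℝ => ∫ y, g (x + s • y) * avgKernel y)
      (s * ∫ y, lap g (x + s • y) * avgPotential y) s := by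
  have hg' : Continuous (fderiv ℝ g) := hg.continuous_fderiv (by norm_num)
  have hint : ∀ {a : Euc N → ℝ}, Continuous a → Integrable fun y => a y * avgKernel y := fun ha =>
    (ha.mul continuous_avgKernel).integrable_of_hasCompactSupport
      hasCompactSupport_avgKernel.mul_left
  have hcont : Continuous fun p : ℝ × Euc N => fderiv ℝ g (x + p.1 • p.2) p.2 :=
    (hg'.comp (by fun_prop)).clm_apply continuous_snd
  obtain ⟨C, hC⟩ := ((isCompact_closedBall s 1).prod
    (isCompact_closedBall (0 : Euc N) 1)).exists_bound_of_continuousOn hcont.continuousOn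
  have key := (hasDerivAt_integral_of_dominated_loc_of_deriv_le (μ := volume) (x₀ := s)
    (F := fun s y => g (x + s • y) * avgKernel y)
    (F' := fun s y => fderiv ℝ g (x + s • y) y * avgKernel y)
    (bound := fun y => C * avgKernel y) (closedBall_mem_nhds s one_pos)
    (Eventually.of_forall fun t =>
      (hint (hg.continuous.comp (by fun_prop))).aestronglyMeasurable)
    (hint (hg.continuous.comp (by fun_prop)))
    (hint ((hg'.comp (by fun_prop)).clm_apply continuous_id)).aestronglyMeasurable
    (ae_of_all _ fun y t ht => by
      by_cases hy : y ∈ closedBall (0 : Euc N) 1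
      · rw [norm_mul, Real.norm_of_nonneg (avgKernel_nonneg y)]
        exact mul_le_mul_of_nonneg_right (hC (t, y) ⟨ht, hy⟩) (avgKernel_nonneg y)
      · simp [avgKernel_eq_zero hy])
    (hint continuous_const)
    (ae_of_all _ fun y t _ => by
      have h1 : HasDerivAt (fun t : ℝ => x + t • y) y t := by
        simpa using ((hasDerivAt_id t).smul_const y).const_add x
      exact (((hg.differentiable (by norm_num)) (x + t • y)).hasFDerivAt.comp_hasDerivAt t
        h1).mul_const _)).2
  refine key.congr_deriv ?_
  have hpart : ∀ i : Fin N, ContDiff ℝ 1 fun z => fderiv ℝ g z (EuclideanSpace.single i 1) :=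
    fun i => (hg.fderiv_right (m := 1) (by norm_num)).clm_apply contDiff_const
  have hpd : ∀ (i : Fin N) (y : Euc N),
      fderiv ℝ (fun y => fderiv ℝ g (x + s • y) (EuclideanSpace.single i 1)) y
        (EuclideanSpace.single i 1) = s * fderiv ℝ
          (fun z => fderiv ℝ g z (EuclideanSpace.single i 1)) (x + s • y)
          (EuclideanSpace.single i 1) := by
    intro i y
    have h1 : HasFDerivAt (fun y : Euc N => x + s • y) (s • ContinuousLinearMap.id ℝ (Euc N)) y :=
      ((hasFDerivAt_id y).const_smul s).const_add x
    have h2 := (((hpart i).differentiable (by norm_num)) (x + s • y)).hasFDerivAt.comp y h1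
    refine (congrArg (fun T => T (EuclideanSpace.single i 1)) h2.fderiv).trans ?_
    simp
  have hibp : ∀ i : Fin N,
      ∫ y, fderiv ℝ g (x + s • y) (EuclideanSpace.single i 1) * (y i * avgKernel y) =
      s * ∫ y, fderiv ℝ (fun z => fderiv ℝ g z (EuclideanSpace.single i 1)) (x + s • y)
          (EuclideanSpace.single i 1) * avgPotential y := by
    intro i
    have hc1 : Continuous fun y => fderiv ℝ g (x + s • y) (EuclideanSpace.single i 1) :=
      (hpart i).continuous.comp (by fun_prop)
    have hc2 : Continuous fun y => fderiv ℝ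
        (fun z => fderiv ℝ g z (EuclideanSpace.single i 1)) (x + s • y)
          (EuclideanSpace.single i 1) :=
      (((hpart i).continuous_fderiv (by norm_num)).comp (by fun_prop)).clm_apply continuous_const
    have hfd : ∀ y : Euc N, fderiv ℝ avgPotential y (EuclideanSpace.single i 1)
        = -(y i * avgKernel y) := by
      intro y
      rw [fderiv_avgPotential_apply, EuclideanSpace.inner_single_right]
      simp [mul_comm]
    have h := integral_mul_fderiv_eq_neg_fderiv_mul_of_integrable (μ := volume)
      (f := fun y => fderiv ℝ g (x + s • y) (EuclideanSpace.single i 1))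
      (g := avgPotential) (v := EuclideanSpace.single i 1) ?_ ?_ ?_ ?_ ?_
    · simp only [hpd, hfd, mul_neg, integral_neg, neg_inj, mul_assoc, integral_const_mul] at h
      exact h
    · simp only [hpd]
      exact ((continuous_const.mul hc2).mul
        continuous_avgPotential).integrable_of_hasCompactSupport
        hasCompactSupport_avgPotential.mul_left
    · simp only [hfd, mul_neg, ← mul_assoc]
      exact (hint (hc1.mul (by fun_prop))).neg
    · exact (hc1.mul continuous_avgPotential).integrable_of_hasCompactSupport
        hasCompactSupport_avgPotential.mul_left
    · exact fun y _ => (((hpart i).differentiable (by norm_num)).comp (by fun_prop)) y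
    · exact fun y _ => differentiable_avgPotential y
  have hsum : ∀ y : Euc N, fderiv ℝ g (x + s • y) y * avgKernel y =
      ∑ i, fderiv ℝ g (x + s • y) (EuclideanSpace.single i 1) * (y i * avgKernel y) := by
    intro y
    have hy : y = ∑ i, y i • (EuclideanSpace.single i (1 : ℝ) : Euc N) := by
      simpa using ((EuclideanSpace.basisFun (Fin N) ℝ).sum_repr y).symm
    conv_lhs => rw [show fderiv ℝ g (x + s • y) y =
      fderiv ℝ g (x + s • y) (∑ i, y i • (EuclideanSpace.single i (1 : ℝ) : Euc N)) by rw [← hy]]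
    rw [map_sum, Finset.sum_mul]
    refine Finset.sum_congr rfl fun i _ => ?_
    rw [map_smul, smul_eq_mul]
    ring
  simp only [hsum, lap, Finset.sum_mul]
  rw [integral_finsetSum, integral_finsetSum, Finset.mul_sum]
  · exact Finset.sum_congr rfl fun i _ => hibp i
  · intro i _
    exact (((((hpart i).continuous_fderiv (by norm_num)).comp (by fun_prop)).clm_apply
      continuous_const).mul continuous_avgPotential).integrable_of_hasCompactSupport
        hasCompactSupport_avgPotential.mul_left
  · intro i _
    simp only [← mul_assoc]
    exact hint (((hpart i).continuous.comp (by fun_prop)).mul (by fun_prop))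

/-- Weak Harnack inequality for nonnegative supersolutions of `-Δ + M` on a ball. -/
theorem setIntegral_ball_le_of_lap_le {N : ℕ} {g : Euc N → ℝ} (hg : ContDiff ℝ 2 g)
    (hg0 : ∀ z, 0 ≤ g z) {x : Euc N} {ρ M : ℝ} (hρ : 0 < ρ) (hM : 0 ≤ M)
    (hlap : ∀ z ∈ ball x ρ, lap g z ≤ M * g z) :
    ∫ z in ball x (ρ / 2), g z ≤
      ρ ^ N * Real.exp (M * ρ * ρ) * (∫ y : Euc N, avgKernel y) * g x := by
  set J : ℝ → ℝ := fun s => ∫ y, g (x + s • y) * avgKernel y with hJ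
  have hintK : ∀ {a : Euc N → ℝ}, Continuous a → Integrable fun y => a y * avgKernel y :=
    fun ha => (ha.mul continuous_avgKernel).integrable_of_hasCompactSupport
      hasCompactSupport_avgKernel.mul_left
  have hintP : ∀ {a : Euc N → ℝ}, Continuous a → Integrable fun y => a y * avgPotential y :=
    fun ha => (ha.mul continuous_avgPotential).integrable_of_hasCompactSupport
      hasCompactSupport_avgPotential.mul_left
  have hlapc : Continuous (lap g) := by
    unfold lap
    refine continuous_finsetSum _ fun i _ => ?_
    have h1 : ContDiff ℝ 1 fun z => fderiv ℝ g z (EuclideanSpace.single i 1) :=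
      (hg.fderiv_right (m := 1) (by norm_num)).clm_apply contDiff_const
    exact (h1.continuous_fderiv (by norm_num)).clm_apply continuous_const
  have hJ0 : ∀ s, 0 ≤ J s := fun s =>
    integral_nonneg fun y => mul_nonneg (hg0 _) (avgKernel_nonneg y)
  have hderiv : ∀ s ∈ Set.Ioo 0 ρ,
      s * ∫ y, lap g (x + s • y) * avgPotential y ≤ M * ρ * J s := by
    intro s hs
    have h1 : ∫ y, lap g (x + s • y) * avgPotential y ≤ M * J s := by
      rw [hJ, ← integral_const_mul]
      refine integral_mono (hintP (hlapc.comp (by fun_prop)))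
        ((hintK (hg.continuous.comp (by fun_prop))).const_mul M) fun y => ?_
      by_cases hy : y ∈ closedBall (0 : Euc N) 1
      · have hz : x + s • y ∈ ball x ρ := by
          rw [mem_ball, dist_self_add_left, norm_smul, Real.norm_of_nonneg hs.1.le]
          rw [mem_closedBall_zero_iff] at hy
          nlinarith [hs.1, hs.2, norm_nonneg y]
        calc lap g (x + s • y) * avgPotential y
            ≤ M * g (x + s • y) * avgPotential y :=
              mul_le_mul_of_nonneg_right (hlap _ hz) (avgPotential_nonneg y)
          _ ≤ M * g (x + s • y) * avgKernel y :=
              mul_le_mul_of_nonneg_left (avgPotential_le_avgKernel y) (mul_nonneg hM (hg0 _))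
          _ = M * (g (x + s • y) * avgKernel y) := by ring
      · simp [avgKernel_eq_zero hy, avgPotential_eq_zero hy]
    calc s * ∫ y, lap g (x + s • y) * avgPotential y ≤ s * (M * J s) :=
          mul_le_mul_of_nonneg_left h1 hs.1.le
      _ ≤ ρ * (M * J s) := mul_le_mul_of_nonneg_right hs.2.le (mul_nonneg hM (hJ0 s))
      _ = M * ρ * J s := by ring
  have hK : ∀ s, HasDerivAt (fun s => Real.exp (-(M * ρ * s)) * J s)
      (Real.exp (-(M * ρ * s)) * (s * (∫ y, lap g (x + s • y) * avgPotential y) - M * ρ * J s))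
      s := by
    intro s
    have h1 : HasDerivAt (fun s => Real.exp (-(M * ρ * s)))
        (Real.exp (-(M * ρ * s)) * -(M * ρ)) s := by
      simpa using (((hasDerivAt_id s).const_mul (M * ρ)).neg).exp
    refine (h1.mul (hasDerivAt_integral_avgKernel hg x s)).congr_deriv ?_
    ring
  have hanti : AntitoneOn (fun s => Real.exp (-(M * ρ * s)) * J s) (Set.Icc 0 ρ) := by
    refine antitoneOn_of_deriv_nonpos (convex_Icc 0 ρ)
      (fun s _ => (hK s).continuousAt.continuousWithinAt)
      (fun s _ => (hK s).differentiableAt.differentiableWithinAt) fun s hs => ?_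
    rw [interior_Icc] at hs
    rw [(hK s).deriv]
    exact mul_nonpos_of_nonneg_of_nonpos (Real.exp_pos _).le (sub_nonpos.2 (hderiv s hs))
  have hJρ : J ρ ≤ Real.exp (M * ρ * ρ) * (∫ y : Euc N, avgKernel y) * g x := by
    have h1 := hanti (Set.left_mem_Icc.2 hρ.le) (Set.right_mem_Icc.2 hρ.le) hρ.le
    have h2 : J 0 = g x * ∫ y : Euc N, avgKernel y := by
      simp [hJ, integral_const_mul]
    simp only [h2, mul_zero, neg_zero, Real.exp_zero, one_mul] at h1
    have h3 := mul_le_mul_of_nonneg_left h1 (Real.exp_pos (M * ρ * ρ)).le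
    rw [← mul_assoc, ← Real.exp_add, add_neg_cancel, Real.exp_zero, one_mul] at h3
    linarith
  have hscale : ρ ^ N * J ρ = ∫ z, g z * avgKernel (ρ⁻¹ • (z - x)) := by
    have h1 := Measure.integral_comp_smul (volume : Measure (Euc N))
      (fun z => g (x + z) * avgKernel (ρ⁻¹ • z)) ρ
    have h2 := integral_add_left_eq_self (μ := (volume : Measure (Euc N)))
      (fun z => g z * avgKernel (ρ⁻¹ • (z - x))) x
    simp only [smul_smul, inv_mul_cancel₀ hρ.ne', one_smul, finrank_euclideanSpace,
      Fintype.card_fin, smul_eq_mul] at h1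
    simp only [add_sub_cancel_left] at h2
    simp only [hJ]
    rw [← h2, h1, abs_of_pos (by positivity), ← mul_assoc, mul_inv_cancel₀ (by positivity), one_mul]
  have hcont : Continuous fun z => g z * avgKernel (ρ⁻¹ • (z - x)) :=
    hg.continuous.mul (continuous_avgKernel.comp (by fun_prop))
  have hint : Integrable fun z => g z * avgKernel (ρ⁻¹ • (z - x)) := by
    refine hcont.integrable_of_hasCompactSupport
      (HasCompactSupport.intro (isCompact_closedBall x ρ) fun z hz => ?_)
    rw [avgKernel_eq_zero, mul_zero]
    rw [mem_closedBall, not_le, dist_eq_norm] at hz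
    rw [mem_closedBall_zero_iff, not_le, norm_smul, norm_inv, Real.norm_of_nonneg hρ.le,
      ← div_eq_inv_mul]
    exact (one_lt_div hρ).2 hz
  have hle : ∫ z in ball x (ρ / 2), g z ≤ ρ ^ N * J ρ := by
    rw [hscale]
    refine le_trans (setIntegral_mono_on
      ((hg.continuous.continuousOn.integrableOn_compact
        (isCompact_closedBall x (ρ / 2))).mono_set ball_subset_closedBall) hint.integrableOn
      measurableSet_ball fun z hz => ?_)
      (setIntegral_le_integral hint (ae_of_all _ fun z => mul_nonneg (hg0 _) (avgKernel_nonneg _)))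
    refine le_mul_of_one_le_right (hg0 z) ?_
    rw [mem_ball, dist_eq_norm] at hz
    have hn : ‖ρ⁻¹ • (z - x)‖ ≤ 1 / 2 := by
      rw [norm_smul, norm_inv, Real.norm_of_nonneg hρ.le, ← div_eq_inv_mul, div_le_iff₀ hρ]
      linarith
    unfold avgKernel
    have h34 : 3 / 4 ≤ max (1 - ‖ρ⁻¹ • (z - x)‖ ^ 2) 0 :=
      le_max_of_le_left (by nlinarith [norm_nonneg (ρ⁻¹ • (z - x))])
    nlinarith
  calc ∫ z in ball x (ρ / 2), g z ≤ ρ ^ N * J ρ := hle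
    _ ≤ ρ ^ N * (Real.exp (M * ρ * ρ) * (∫ y : Euc N, avgKernel y) * g x) := by gcongr
    _ = _ := by ring

/-- Nonnegative classical supersolutions of `-Δ - μ|x|⁻²` on the punctured space. -/
def IsNonnegSupersolution (N : ℕ) (μ : ℝ) (w : Euc N → ℝ) : Prop :=
  ContDiffOn ℝ 2 w {x : Euc N | x ≠ 0} ∧ (∀ x : Euc N, x ≠ 0 → 0 ≤ w x) ∧
  ∀ x : Euc N, x ≠ 0 → 0 ≤ -lap w x - μ * ‖x‖ ^ (-2 : ℝ) * w x

theorem isOpen_ne_zero (N : ℕ) : IsOpen {x : Euc N | x ≠ 0} := isOpen_compl_singleton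

theorem exists_setIntegral_ball_le (N : ℕ) (μ : ℝ) :
    ∃ C > 0, ∀ w : Euc N → ℝ, IsNonnegSupersolution N μ w → ∀ x : Euc N, 7 / 8 ≤ ‖x‖ →
      ∫ z in ball x (3 / 8), w z ≤ C * w x := by
  have hKint : 0 ≤ ∫ y : Euc N, avgKernel y := integral_nonneg avgKernel_nonneg
  set C₀ := (3 / 4 : ℝ) ^ N * Real.exp (64 * |μ| * (3 / 4) * (3 / 4)) *
    (∫ y : Euc N, avgKernel y) with hC₀
  have hC₀' : 0 ≤ C₀ := by positivity
  refine ⟨C₀ + 1, by positivity, fun w hw x hx => ?_⟩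
  obtain ⟨hw2, hw0, hweq⟩ := hw
  let χ : ContDiffBump (0 : Euc N) := ⟨1 / 16, 1 / 8, by norm_num, by norm_num⟩
  set g : Euc N → ℝ := fun y => (1 - χ y) * w y with hg
  have hgw : ∀ y : Euc N, 1 / 8 ≤ ‖y‖ → g y = w y := fun y hy => by
    simp [hg, χ.zero_of_le_dist (x := y) (by simpa [χ] using hy)]
  have hg2 : ContDiff ℝ 2 g := contDiff_iff_contDiffAt.2 fun y => by
    by_cases hy : y = 0
    · subst hy
      have : g =ᶠ[nhds 0] fun _ => 0 := by
        filter_upwards [χ.eventuallyEq_one] with z hz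
        simp only [Pi.one_apply] at hz
        simp [hg, hz]
      exact contDiffAt_const.congr_of_eventuallyEq this
    · exact (contDiffAt_const.sub χ.contDiffAt).mul
        (hw2.contDiffAt ((isOpen_ne_zero N).mem_nhds hy))
  have hg0 : ∀ z, 0 ≤ g z := fun z => by
    by_cases hz : z = 0
    · subst hz
      simp [hg, χ.one_of_mem_closedBall (mem_closedBall_self χ.rIn_pos.le)]
    · exact mul_nonneg (sub_nonneg.2 χ.le_one) (hw0 z hz)
  have hball : ∀ z ∈ ball x (3 / 4), 1 / 8 < ‖z‖ := fun z hz => by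
    rw [mem_ball, dist_eq_norm, norm_sub_rev] at hz
    linarith [norm_sub_norm_le x z]
  have hlap : ∀ z ∈ ball x (3 / 4), lap g z ≤ 64 * |μ| * g z := fun z hz => by
    have hz8 := hball z hz
    have hz0 : z ≠ 0 := norm_pos_iff.1 (by linarith)
    have he : g =ᶠ[nhds z] w := by
      filter_upwards [(continuous_norm.tendsto z).eventually (lt_mem_nhds hz8)] with y hy
      exact hgw y hy.le
    rw [he.lap_eq, hgw z hz8.le]
    have h1 : ‖z‖ ^ (-2 : ℝ) ≤ 64 := by
      rw [Real.rpow_neg (norm_nonneg z), show (2 : ℝ) = (2 : ℕ) by norm_num, Real.rpow_natCast]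
      refine inv_le_of_inv_le₀ (by norm_num) ?_
      nlinarith
    have h2 : 0 ≤ ‖z‖ ^ (-2 : ℝ) := by positivity
    have h3 : -(μ * ‖z‖ ^ (-2 : ℝ)) ≤ 64 * |μ| := by
      nlinarith [neg_abs_le μ, abs_nonneg μ]
    nlinarith [hweq z hz0, mul_le_mul_of_nonneg_right h3 (hw0 z hz0)]
  have key := setIntegral_ball_le_of_lap_le hg2 hg0 (by norm_num : (0 : ℝ) < 3 / 4)
    (by positivity) hlap
  rw [← hC₀, hgw x (by linarith), show (3 / 4 / 2 : ℝ) = 3 / 8 by norm_num] at key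
  rw [setIntegral_congr_fun (g := g) measurableSet_ball fun z hz =>
    (hgw z (hball z (ball_subset_ball (by norm_num) hz)).le).symm]
  have hwx : 0 ≤ w x := hw0 x (norm_pos_iff.1 (by linarith))
  linarith

theorem IsNonnegSupersolution.integrableOn {N : ℕ} {μ : ℝ} {w : Euc N → ℝ}
    (hw : IsNonnegSupersolution N μ w) {K s : Set (Euc N)} (hK : IsCompact K)
    (hK0 : ∀ z ∈ K, z ≠ 0) (hs : s ⊆ K) : IntegrableOn w s :=
  ((hw.1.continuousOn.mono hK0).integrableOn_compact hK).mono_set hs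

theorem ne_zero_of_mem_closedBall {N : ℕ} {x z : Euc N} {r : ℝ} (hr : r < ‖x‖)
    (hz : z ∈ closedBall x r) : z ≠ 0 := by
  rintro rfl
  rw [mem_closedBall, dist_comm, dist_zero_right] at hz
  linarith

theorem IsNonnegSupersolution.setIntegral_ball_le_setIntegral_ball {N : ℕ} {μ : ℝ}
    {w : Euc N → ℝ} (hw : IsNonnegSupersolution N μ w) {x y : Euc N} {r s : ℝ} (hs : s < ‖y‖)
    (hrs : r + dist x y ≤ s) : ∫ z in ball x r, w z ≤ ∫ z in ball y s, w z := by
  refine setIntegral_mono_set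
    (hw.integrableOn (isCompact_closedBall y s) (fun z => ne_zero_of_mem_closedBall hs)
      ball_subset_closedBall) ?_ (ball_subset_ball' hrs).eventuallyLE
  filter_upwards [ae_restrict_mem measurableSet_ball] with z hz
  exact hw.2.1 z (ne_zero_of_mem_closedBall hs (ball_subset_closedBall hz))

/-- Harnack chain along the unit sphere. -/
theorem exists_setIntegral_ball_le_setIntegral_ball {N : ℕ} (hN : 3 ≤ N) (μ : ℝ) {x y : Euc N}
    (hx : ‖x‖ = 1) (hy : ‖y‖ = 1) :
    ∃ C > 0, ∀ w : Euc N → ℝ, IsNonnegSupersolution N μ w →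
      ∫ z in ball y (1 / 8), w z ≤ C * ∫ z in ball x (1 / 8), w z := by
  obtain ⟨C, hC, hball⟩ := exists_setIntegral_ball_le N μ
  have hstep : ∀ x y : Euc N, ‖x‖ = 1 → ‖y‖ = 1 → dist x y < 1 / 8 →
      ∃ C > 0, ∀ w : Euc N → ℝ, IsNonnegSupersolution N μ w →
      ∫ z in ball y (1 / 8), w z ≤ C * ∫ z in ball x (1 / 8), w z := by
    intro x y hx hy hxy
    have hv : 0 < volume.real (ball x (1 / 8)) :=
      ENNReal.toReal_pos (measure_ball_pos volume x (by norm_num)).ne' measure_ball_lt_top.ne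
    refine ⟨C / volume.real (ball x (1 / 8)), by positivity, fun w hw => ?_⟩
    rw [div_mul_eq_mul_div, le_div_iff₀ hv, ← integral_const_mul]
    have hint : IntegrableOn w (ball x (1 / 8)) :=
      hw.integrableOn (isCompact_closedBall x (1 / 8))
        (fun z => ne_zero_of_mem_closedBall (by rw [hx]; norm_num)) ball_subset_closedBall
    have h1 : ∫ _ in ball x (1 / 8), (∫ z in ball y (1 / 8), w z) ≤
        ∫ z in ball x (1 / 8), C * w z := by
      refine setIntegral_mono_on (integrableOn_const measure_ball_lt_top.ne)
        (hint.const_mul C) measurableSet_ball fun z hz => ?_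
      rw [mem_ball] at hz
      have hz' : 7 / 8 ≤ ‖z‖ := by
        have := norm_sub_norm_le x z
        rw [← dist_eq_norm, dist_comm] at this
        linarith
      refine (hw.setIntegral_ball_le_setIntegral_ball (by linarith) ?_).trans (hball w hw z hz')
      have := dist_triangle_right y z x
      rw [dist_comm y x] at this
      linarith
    rw [setIntegral_const, smul_eq_mul, mul_comm] at h1
    exact h1
  have hrank : 1 < Module.rank ℝ (Euc N) := by
    rw [rank_eq_card_basis (EuclideanSpace.basisFun (Fin N) ℝ).toBasis]
    simp only [Fintype.card_fin]
    exact_mod_cast (by omega : 1 < N)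
  refine (isPreconnected_sphere hrank (0 : Euc N) 1).induction₂'
    (fun x y => ∃ C > 0, ∀ w : Euc N → ℝ, IsNonnegSupersolution N μ w →
      ∫ z in ball y (1 / 8), w z ≤ C * ∫ z in ball x (1 / 8), w z) ?_ ?_
    (mem_sphere_zero_iff_norm.2 hx) (mem_sphere_zero_iff_norm.2 hy)
  · intro x hx
    rw [mem_sphere_zero_iff_norm] at hx
    filter_upwards [self_mem_nhdsWithin,
      mem_nhdsWithin_of_mem_nhds (ball_mem_nhds x (by norm_num : (0 : ℝ) < 1 / 8))] with y hy hyx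
    rw [mem_sphere_zero_iff_norm] at hy
    rw [mem_ball] at hyx
    exact ⟨hstep x y hx hy (by rwa [dist_comm]), hstep y x hy hx hyx⟩
  · rintro x y z - - - ⟨C₁, h1, h1'⟩ ⟨C₂, h2, h2'⟩
    refine ⟨C₂ * C₁, by positivity, fun w hw => (h2' w hw).trans ?_⟩
    rw [mul_assoc]
    exact mul_le_mul_of_nonneg_left (h1' w hw) h2.le

/-- A nonnegative supersolution on the unit sphere controls its mass in an annulus. -/
theorem exists_setIntegral_annulus_le {N : ℕ} (hN : 3 ≤ N) (μ : ℝ) :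
    ∃ C > 0, ∀ w : Euc N → ℝ, IsNonnegSupersolution N μ w → ∀ x : Euc N, ‖x‖ = 1 →
      ∫ z in {z : Euc N | 1 ≤ ‖z‖ ∧ ‖z‖ ≤ 17 / 16}, w z ≤ C * w x := by
  obtain ⟨C, hC, hball⟩ := exists_setIntegral_ball_le N μ
  obtain ⟨T, hTs, hT⟩ := (isCompact_sphere (0 : Euc N) 1).elim_nhds_subcover
    (fun x => ball x (1 / 16)) fun x _ => ball_mem_nhds x (by norm_num)
  choose! D hD0 hD using fun (t y : Euc N) (ht : ‖t‖ = 1) (hy : ‖y‖ = 1) =>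
    exists_setIntegral_ball_le_setIntegral_ball hN μ ht hy
  have hT1 : ∀ t ∈ T, ‖t‖ = 1 := fun t ht => mem_sphere_zero_iff_norm.1 (hTs t ht)
  have hcover : ∀ x : Euc N, ‖x‖ = 1 → ∃ t ∈ T, dist x t < 1 / 16 := fun x hx => by
    simpa using hT (mem_sphere_zero_iff_norm.2 hx)
  have hsum : 0 ≤ ∑ t ∈ T, ∑ y ∈ T, D t y := Finset.sum_nonneg fun t ht =>
    Finset.sum_nonneg fun y hy => (hD0 t y (hT1 t ht) (hT1 y hy)).le
  refine ⟨(∑ t ∈ T, ∑ y ∈ T, D t y) * C + 1, by positivity, fun w hw x hx => ?_⟩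
  have hw0 : ∀ t ∈ T, 0 ≤ ∫ z in ball t (1 / 8), w z := fun t ht =>
    setIntegral_nonneg measurableSet_ball fun z hz => hw.2.1 z
      (ne_zero_of_mem_closedBall (by rw [hT1 t ht]; norm_num) (ball_subset_closedBall hz))
  have hint : ∀ t ∈ T, IntegrableOn w (ball t (1 / 8)) := fun t ht =>
    hw.integrableOn (isCompact_closedBall t (1 / 8))
        (fun z => ne_zero_of_mem_closedBall (by rw [hT1 t ht]; norm_num)) ball_subset_closedBall
  have hsub : {z : Euc N | 1 ≤ ‖z‖ ∧ ‖z‖ ≤ 17 / 16} ⊆ ⋃ t ∈ T, ball t (1 / 8) := by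
    rintro z ⟨hz1, hz2⟩
    have hz0 : 0 < ‖z‖ := by linarith
    obtain ⟨t, ht, hzt⟩ := hcover (‖z‖⁻¹ • z) (by
      rw [norm_smul, norm_inv, norm_norm, inv_mul_cancel₀ hz0.ne'])
    refine Set.mem_biUnion ht ?_
    have h1 : dist z (‖z‖⁻¹ • z) ≤ 1 / 16 := by
      have h2 : z - ‖z‖⁻¹ • z = (1 - ‖z‖⁻¹) • z := by rw [sub_smul, one_smul]
      rw [dist_eq_norm, h2, norm_smul, Real.norm_of_nonneg (sub_nonneg.2 (inv_le_one_of_one_le₀ hz1)),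
        sub_mul, inv_mul_cancel₀ hz0.ne']
      linarith
    rw [mem_ball]
    linarith [dist_triangle z (‖z‖⁻¹ • z) t]
  have hA : ∫ z in {z : Euc N | 1 ≤ ‖z‖ ∧ ‖z‖ ≤ 17 / 16}, w z ≤
      ∑ y ∈ T, ∫ z in ball y (1 / 8), w z := by
    have hm : MeasurableSet {z : Euc N | 1 ≤ ‖z‖ ∧ ‖z‖ ≤ 17 / 16} :=
      (measurableSet_le measurable_const measurable_norm).inter
        (measurableSet_le measurable_norm measurable_const)
    have hA0 : ∀ z ∈ {z : Euc N | 1 ≤ ‖z‖ ∧ ‖z‖ ≤ 17 / 16}, 0 ≤ w z := fun z hz =>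
      hw.2.1 z (norm_pos_iff.1 (by linarith [hz.1]))
    simp only [← integral_indicator measurableSet_ball, ← integral_indicator hm]
    rw [← integral_finsetSum]
    · refine integral_mono_of_nonneg (ae_of_all _ fun z => Set.indicator_nonneg hA0 z)
        (integrable_finsetSum _ fun t ht => (hint t ht).integrable_indicator measurableSet_ball)
        (ae_of_all _ fun z => ?_)
      have hnn : ∀ t ∈ T, 0 ≤ (ball t (1 / 8)).indicator w z := fun t ht =>
        Set.indicator_nonneg (fun z hz => hw.2.1 z
          (ne_zero_of_mem_closedBall (by rw [hT1 t ht]; norm_num) (ball_subset_closedBall hz))) z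
      by_cases hz : z ∈ {z : Euc N | 1 ≤ ‖z‖ ∧ ‖z‖ ≤ 17 / 16}
      · obtain ⟨t, ht, hzt⟩ := Set.mem_iUnion₂.1 (hsub hz)
        simp only [Set.indicator_of_mem hz]
        calc w z = (ball t (1 / 8)).indicator w z := (Set.indicator_of_mem hzt w).symm
          _ ≤ _ := Finset.single_le_sum hnn ht
      · simp only [Set.indicator_of_notMem hz]
        exact Finset.sum_nonneg hnn
    · exact fun t ht => (hint t ht).integrable_indicator measurableSet_ball
  obtain ⟨t, ht, hxt⟩ := hcover x hx
  have htx : ∫ z in ball t (1 / 8), w z ≤ C * w x :=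
    (hw.setIntegral_ball_le_setIntegral_ball (by rw [hx]; norm_num)
      (by rw [dist_comm]; linarith)).trans (hball w hw x (by rw [hx]; norm_num))
  have hwx : 0 ≤ w x := hw.2.1 x (norm_pos_iff.1 (by rw [hx]; norm_num))
  have hle : ∑ y ∈ T, D t y ≤ ∑ t ∈ T, ∑ y ∈ T, D t y :=
    Finset.single_le_sum (f := fun t => ∑ y ∈ T, D t y) (fun t ht =>
      Finset.sum_nonneg fun y hy => (hD0 t y (hT1 t ht) (hT1 y hy)).le) ht
  calc _ ≤ ∑ y ∈ T, ∫ z in ball y (1 / 8), w z := hA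
    _ ≤ ∑ y ∈ T, D t y * ∫ z in ball t (1 / 8), w z :=
      Finset.sum_le_sum fun y hy => hD t y (hT1 t ht) (hT1 y hy) w hw
    _ = (∑ y ∈ T, D t y) * ∫ z in ball t (1 / 8), w z := (Finset.sum_mul ..).symm
    _ ≤ (∑ t ∈ T, ∑ y ∈ T, D t y) * (C * w x) :=
      mul_le_mul hle htx (hw0 t ht) hsum
    _ ≤ _ := by linarith

/-- A smooth cutoff equal to `1` on `(-∞, 1]` and to `0` on `[9 / 8, ∞)`. -/
def cutoff (t : ℝ) : ℝ := Real.smoothTransition (9 - 8 * t)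

theorem contDiff_cutoff {n : ℕ} : ContDiff ℝ n cutoff :=
  (Real.smoothTransition.contDiff (n := n)).comp (by fun_prop)

theorem cutoff_of_le_one {t : ℝ} (ht : t ≤ 1) : cutoff t = 1 :=
  Real.smoothTransition.one_of_one_le (by linarith)

theorem cutoff_of_ge {t : ℝ} (ht : 9 / 8 ≤ t) : cutoff t = 0 :=
  Real.smoothTransition.zero_of_nonpos (by linarith)

theorem cutoff_nonneg (t : ℝ) : 0 ≤ cutoff t := Real.smoothTransition.nonneg _

theorem contDiff_deriv_cutoff {n : ℕ} : ContDiff ℝ n (deriv cutoff) := by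
  have h := contDiff_cutoff (n := n + 1)
  push_cast at h
  exact (contDiff_succ_iff_deriv.1 h).2.2

theorem hasDerivAt_cutoff (t : ℝ) : HasDerivAt cutoff (deriv cutoff t) t :=
  ((contDiff_cutoff (n := 1)).differentiable (by norm_num) t).hasDerivAt

theorem hasDerivAt_deriv_cutoff (t : ℝ) :
    HasDerivAt (deriv cutoff) (deriv (deriv cutoff) t) t :=
  ((contDiff_deriv_cutoff (n := 1)).differentiable (by norm_num) t).hasDerivAt

theorem continuous_deriv_cutoff : Continuous (deriv cutoff) :=
  (contDiff_deriv_cutoff (n := 1)).continuous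

theorem continuous_deriv_deriv_cutoff : Continuous (deriv (deriv cutoff)) :=
  (contDiff_deriv_cutoff (n := 1)).continuous_deriv (by norm_num)

theorem deriv_cutoff_eventuallyEq_zero {t : ℝ} (ht : t < 1 ∨ 9 / 8 < t) :
    deriv cutoff =ᶠ[nhds t] fun _ => 0 := by
  have : ∃ c, cutoff =ᶠ[nhds t] fun _ => c := by
    rcases ht with ht | ht
    · refine ⟨1, ?_⟩
      filter_upwards [gt_mem_nhds ht] with s hs using cutoff_of_le_one hs.le
    · refine ⟨0, ?_⟩
      filter_upwards [lt_mem_nhds ht] with s hs using cutoff_of_ge hs.le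
  obtain ⟨c, hc⟩ := this
  filter_upwards [hc.eventuallyEq_nhds] with s hs
  simp [hs.deriv_eq]

theorem deriv_cutoff_eq_zero {t : ℝ} (ht : t < 1 ∨ 9 / 8 < t) : deriv cutoff t = 0 :=
  (deriv_cutoff_eventuallyEq_zero ht).eq_of_nhds

theorem deriv_deriv_cutoff_eq_zero {t : ℝ} (ht : t < 1 ∨ 9 / 8 < t) :
    deriv (deriv cutoff) t = 0 := by
  simp [(deriv_cutoff_eventuallyEq_zero ht).deriv_eq]

theorem isC11c_cutoff {N : ℕ} {r : ℝ} (hr : 0 < r) :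
    IsC11c fun x : Euc N => cutoff (‖r⁻¹ • x‖ ^ 2) := by
  have h2 : ContDiff ℝ 2 fun x : Euc N => cutoff (‖r⁻¹ • x‖ ^ 2) :=
    (contDiff_cutoff (n := 2)).comp ((contDiff_norm_sq ℝ).comp (by fun_prop))
  have hc : HasCompactSupport fun x : Euc N => cutoff (‖r⁻¹ • x‖ ^ 2) := by
    refine HasCompactSupport.of_support_subset_isCompact (isCompact_closedBall 0 (2 * r)) ?_
    intro x hx
    by_contra hxr
    refine hx (cutoff_of_ge ?_)
    rw [mem_closedBall, dist_zero_right, not_le] at hxr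
    have : 2 ≤ ‖r⁻¹ • x‖ := by
      rw [norm_smul, Real.norm_of_nonneg (by positivity), inv_mul_eq_div, le_div_iff₀ hr]
      exact hxr.le
    nlinarith
  exact ⟨hc, h2.differentiable (by norm_num),
    (h2.fderiv_right (m := 1) (by norm_num)).lipschitzWith_of_hasCompactSupport
      (hc.fderiv (𝕜 := ℝ)) (by norm_num)⟩

/-- The adjoint operator applied to `x ↦ cutoff (‖x‖ ^ 2)`, as a function of `‖x‖`. -/
def cutoffAdjoint (N : ℕ) (μ s : ℝ) : ℝ :=
  -(4 * s ^ 2 * deriv (deriv cutoff) (s ^ 2)) - (2 * N + 4 * tauPlus N μ) * deriv cutoff (s ^ 2)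

theorem continuous_cutoffAdjoint (N : ℕ) (μ : ℝ) : Continuous (cutoffAdjoint N μ) := by
  have h1 := continuous_deriv_cutoff
  have h2 := continuous_deriv_deriv_cutoff
  unfold cutoffAdjoint
  fun_prop

theorem cutoffAdjoint_eq_zero {N : ℕ} {μ s : ℝ} (hs0 : 0 ≤ s) (hs : ¬(1 ≤ s ∧ s ≤ 17 / 16)) :
    cutoffAdjoint N μ s = 0 := by
  have : s ^ 2 < 1 ∨ 9 / 8 < s ^ 2 := by
    by_cases h : 1 ≤ s
    · right
      have : 17 / 16 < s := by
        by_contra h'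
        exact hs ⟨h, not_lt.1 h'⟩
      nlinarith
    · left
      nlinarith
  simp [cutoffAdjoint, deriv_cutoff_eq_zero this, deriv_deriv_cutoff_eq_zero this]

theorem lstarMu_cutoff {N : ℕ} {μ : ℝ} (x : Euc N) :
    LstarMu N μ (fun y : Euc N => cutoff (‖y‖ ^ 2)) x = cutoffAdjoint N μ ‖x‖ := by
  unfold LstarMu cutoffAdjoint
  rw [lap_radial (θ := cutoff) (Eventually.of_forall hasDerivAt_cutoff)
    (hasDerivAt_deriv_cutoff _), fderiv_radial_apply (hasDerivAt_cutoff _),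
    real_inner_self_eq_norm_sq]
  by_cases hx : x = 0
  · subst hx
    simp [deriv_cutoff_eq_zero (t := 0) (by norm_num)]
  · have : ‖x‖ ≠ 0 := norm_ne_zero_iff.2 hx
    field_simp
    ring

theorem lstarMu_comp_smul {N : ℕ} {μ r : ℝ} (hr : r ≠ 0) (ξ : Euc N → ℝ) (x : Euc N) :
    LstarMu N μ (fun y => ξ (r • y)) x = r ^ 2 * LstarMu N μ ξ (r • x) := by
  unfold LstarMu
  rw [lap_comp_smul, fderiv_comp_smul, norm_smul, mul_pow, Real.norm_eq_abs, sq_abs]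
  simp only [smul_apply, map_smul, smul_eq_mul]
  by_cases hx : x = 0
  · subst hx
    simp
  · have : ‖x‖ ≠ 0 := norm_ne_zero_iff.2 hx
    field_simp

theorem integral_Ioi_mul_cutoffAdjoint (N : ℕ) (μ : ℝ) :
    ∫ s in Set.Ioi (0 : ℝ), s * cutoffAdjoint N μ s = 2 * Real.sqrt (mu0 N - μ) := by
  have hderiv : ∀ s : ℝ, HasDerivAt (fun s => -(2 * s ^ 2 * deriv cutoff (s ^ 2))
      - (N - 2 + 2 * tauPlus N μ) * cutoff (s ^ 2)) (s * cutoffAdjoint N μ s) s := fun s => by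
    have h0 : HasDerivAt (fun s : ℝ => s ^ 2) (2 * s) s := by simpa using hasDerivAt_pow 2 s
    have h1 := (hasDerivAt_cutoff (s ^ 2)).comp s h0
    have h2 := (hasDerivAt_deriv_cutoff (s ^ 2)).comp s h0
    refine (((h0.const_mul 2).mul h2).neg.sub
      (h1.const_mul (N - 2 + 2 * tauPlus N μ))).congr_deriv ?_
    simp only [cutoffAdjoint, Function.comp_apply]
    ring
  have hz : ∀ s : ℝ, 2 < s → s * cutoffAdjoint N μ s = 0 := fun s hs => by
    rw [cutoffAdjoint_eq_zero (by linarith) (by rintro ⟨-, h⟩; linarith), mul_zero]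
  rw [integral_Ioi_of_hasDerivAt_of_tendsto' (m := 0) (fun s _ => hderiv s)]
  · rw [cutoff_of_le_one (by norm_num)]
    unfold tauPlus
    ring
  · have hi : IntegrableOn (fun s => s * cutoffAdjoint N μ s) (Set.Icc 0 2) :=
      (continuous_id.mul (continuous_cutoffAdjoint N μ)).continuousOn.integrableOn_compact
        isCompact_Icc
    refine hi.of_forall_sdiff_eq_zero measurableSet_Ioi fun s hs => hz s ?_
    by_contra h
    exact hs.2 ⟨le_of_lt hs.1, not_lt.1 h⟩
  · refine tendsto_const_nhds.congr' ?_
    filter_upwards [eventually_gt_atTop 2] with s hs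
    have h : 9 / 8 < s ^ 2 := by nlinarith
    simp [deriv_cutoff_eq_zero (Or.inr h), cutoff_of_ge h.le]

theorem integral_rpow_mul_cutoffAdjoint {N : ℕ} (hN : 3 ≤ N) {μ : ℝ} (hμ : μ < mu0 N) :
    ∫ y : Euc N, ‖y‖ ^ tauMinus N μ * cutoffAdjoint N μ ‖y‖ * ‖y‖ ^ tauPlus N μ = cMu N μ := by
  have : Nonempty (Fin N) := ⟨⟨0, by omega⟩⟩
  have h := integral_fun_norm_addHaar (volume : Measure (Euc N))
    fun s : ℝ => s ^ tauMinus N μ * cutoffAdjoint N μ s * s ^ tauPlus N μ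
  have h2 : ∫ s in Set.Ioi (0 : ℝ), s ^ (N - 1) •
      (s ^ tauMinus N μ * cutoffAdjoint N μ s * s ^ tauPlus N μ) =
      ∫ s in Set.Ioi (0 : ℝ), s * cutoffAdjoint N μ s := by
    refine setIntegral_congr_fun measurableSet_Ioi fun s (hs : 0 < s) => ?_
    have : s ^ (N - 1) * s ^ tauMinus N μ * s ^ tauPlus N μ = s := by
      rw [← Real.rpow_natCast, ← Real.rpow_add hs, ← Real.rpow_add hs, Nat.cast_sub (by omega)]
      have : ((N : ℝ) - (1 : ℕ)) + tauMinus N μ + tauPlus N μ = 1 := by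
        unfold tauMinus tauPlus
        push_cast
        ring
      rw [this, Real.rpow_one]
    simp only [smul_eq_mul]
    linear_combination cutoffAdjoint N μ s * this
  rw [finrank_euclideanSpace_fin, h2, integral_Ioi_mul_cutoffAdjoint] at h
  rw [h, cMu, if_pos hμ, sphereArea]
  simp only [nsmul_eq_mul, smul_eq_mul, Measure.real]
  ring

theorem cMu_pos {N : ℕ} (hN : 3 ≤ N) {μ : ℝ} (hμ : μ < mu0 N) : 0 < cMu N μ := by
  have h1 : 0 < Real.sqrt (mu0 N - μ) := Real.sqrt_pos.2 (sub_pos.2 hμ)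
  have h2 : 0 < (volume (ball (0 : Euc N) 1)).toReal :=
    ENNReal.toReal_pos (measure_ball_pos volume _ one_pos).ne' measure_ball_lt_top.ne
  have h3 : (0 : ℝ) < N := by exact_mod_cast (by omega : 0 < N)
  rw [cMu, if_pos hμ, sphereArea]
  positivity

theorem tauMinus_mul_add {N : ℕ} {μ : ℝ} (hμ : μ < mu0 N) :
    tauMinus N μ * (tauMinus N μ + N - 2) = -μ := by
  have h := Real.sq_sqrt (sub_pos.2 hμ).le
  unfold tauMinus
  unfold mu0 at *
  linear_combination h

theorem isNonnegSupersolution_sub {N : ℕ} {μ : ℝ} (hμ : μ < mu0 N) {u : Euc N → ℝ}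
    (hu : IsNonnegSupersolution N μ u) {a r : ℝ} (hr : 0 < r)
    (hau : ∀ x : Euc N, x ≠ 0 → a * ‖x‖ ^ tauMinus N μ ≤ u x) :
    IsNonnegSupersolution N μ
      fun x => u (r • x) - a * r ^ tauMinus N μ * ‖x‖ ^ tauMinus N μ := by
  have hv : ∀ x : Euc N, x ≠ 0 → ContDiffAt ℝ 2 (fun y : Euc N => ‖y‖ ^ tauMinus N μ) x :=
    fun x hx => (contDiffAt_norm ℝ hx).rpow_const_of_ne (norm_ne_zero_iff.2 hx)
  have hur : ∀ x : Euc N, x ≠ 0 → ContDiffAt ℝ 2 (fun y : Euc N => u (r • y)) x := fun x hx =>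
    ContDiffAt.comp x (hu.1.contDiffAt ((isOpen_ne_zero N).mem_nhds (smul_ne_zero hr.ne' hx)))
      (contDiff_const_smul r).contDiffAt
  refine ⟨fun x hx => ((hur x hx).sub (contDiffAt_const.mul (hv x hx))).contDiffWithinAt,
    fun x hx => ?_, fun x hx => ?_⟩
  · have h := hau (r • x) (smul_ne_zero hr.ne' hx)
    rw [norm_smul, Real.norm_of_nonneg hr.le, Real.mul_rpow hr.le (norm_nonneg x)] at h
    linarith
  · rw [lap_sub_const_mul _ (hur x hx) (hv x hx), lap_comp_smul, lap_norm_rpow _ hx,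
      tauMinus_mul_add hμ]
    have h := mul_nonneg (sq_nonneg r) (hu.2.2 (r • x) (smul_ne_zero hr.ne' hx))
    have h1 : r ^ 2 * r ^ (-2 : ℝ) = 1 := by
      rw [← Real.rpow_natCast, ← Real.rpow_add hr]
      norm_num
    rw [norm_smul, Real.norm_of_nonneg hr.le, Real.mul_rpow hr.le (norm_nonneg x)] at h
    refine h.trans_eq ?_
    linear_combination (-μ * ‖x‖ ^ (-2 : ℝ) * u (r • x)) * h1

theorem isCompact_annulus (N : ℕ) : IsCompact {z : Euc N | 1 ≤ ‖z‖ ∧ ‖z‖ ≤ 17 / 16} := by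
  refine (isCompact_closedBall (0 : Euc N) (17 / 16)).of_isClosed_subset ?_
    fun z hz => mem_closedBall_zero_iff.2 hz.2
  exact (isClosed_le continuous_const continuous_norm).inter
    (isClosed_le continuous_norm continuous_const)

theorem ne_zero_of_mem_annulus {N : ℕ} {z : Euc N}
    (hz : z ∈ {z : Euc N | 1 ≤ ‖z‖ ∧ ‖z‖ ≤ 17 / 16}) :
    z ≠ 0 := norm_pos_iff.1 (by linarith [hz.1])

theorem integrable_mul_cutoffAdjoint {N : ℕ} (μ : ℝ) {w : Euc N → ℝ}
    (hw : ContinuousOn w {x : Euc N | x ≠ 0}) :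
    Integrable fun y : Euc N => w y * cutoffAdjoint N μ ‖y‖ * ‖y‖ ^ tauPlus N μ := by
  rw [← integrableOn_iff_integrable_of_support_subset (s := {z : Euc N | 1 ≤ ‖z‖ ∧ ‖z‖ ≤ 17 / 16})]
  · refine ContinuousOn.integrableOn_compact (isCompact_annulus N) ?_
    refine ((hw.mono fun z => ne_zero_of_mem_annulus).mul
      ((continuous_cutoffAdjoint N μ).comp continuous_norm).continuousOn).mul ?_
    exact continuous_norm.continuousOn.rpow_const fun z hz =>
      Or.inl (norm_ne_zero_iff.2 (ne_zero_of_mem_annulus hz))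
  · intro z hz
    by_contra h
    exact hz (by simp [cutoffAdjoint_eq_zero (norm_nonneg z) h])

theorem exists_integral_mul_cutoffAdjoint_le {N : ℕ} (hN : 3 ≤ N) (μ : ℝ) :
    ∃ C > 0, ∀ w : Euc N → ℝ, IsNonnegSupersolution N μ w → ∀ x : Euc N, ‖x‖ = 1 →
      ∫ y : Euc N, w y * cutoffAdjoint N μ ‖y‖ * ‖y‖ ^ tauPlus N μ ≤ C * w x := by
  obtain ⟨C, hC, hCw⟩ := exists_setIntegral_annulus_le hN μ
  obtain ⟨B, hB⟩ := (isCompact_Icc (a := (1 : ℝ)) (b := 17 / 16)).exists_bound_of_continuousOn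
    (f := fun s => cutoffAdjoint N μ s * s ^ tauPlus N μ)
    ((continuous_cutoffAdjoint N μ).continuousOn.mul
      (continuousOn_id.rpow_const fun s hs => Or.inl (by linarith [hs.1] : (0 : ℝ) < s).ne'))
  have hB0 : 0 ≤ B := (norm_nonneg _).trans (hB 1 ⟨le_rfl, by norm_num⟩)
  refine ⟨(B + 1) * C, by positivity, fun w hw x hx => ?_⟩
  have hint := hw.integrableOn (isCompact_annulus N) (fun z => ne_zero_of_mem_annulus) subset_rfl
  rw [← setIntegral_eq_integral_of_forall_compl_eq_zero
    (s := {z : Euc N | 1 ≤ ‖z‖ ∧ ‖z‖ ≤ 17 / 16}) fun z hz => by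
      simp [cutoffAdjoint_eq_zero (norm_nonneg z) hz]]
  calc ∫ y in {z : Euc N | 1 ≤ ‖z‖ ∧ ‖z‖ ≤ 17 / 16},
        w y * cutoffAdjoint N μ ‖y‖ * ‖y‖ ^ tauPlus N μ
      ≤ ∫ y in {z : Euc N | 1 ≤ ‖z‖ ∧ ‖z‖ ≤ 17 / 16}, (B + 1) * w y := by
        refine setIntegral_mono_on (integrable_mul_cutoffAdjoint μ hw.1.continuousOn).integrableOn
          (hint.const_mul _) (isCompact_annulus N).measurableSet fun z hz => ?_
        have h1 := (le_abs_self _).trans (hB ‖z‖ hz)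
        have h2 := hw.2.1 z (ne_zero_of_mem_annulus hz)
        nlinarith
    _ = (B + 1) * ∫ y in {z : Euc N | 1 ≤ ‖z‖ ∧ ‖z‖ ≤ 17 / 16}, w y := integral_const_mul _ _
    _ ≤ (B + 1) * (C * w x) := mul_le_mul_of_nonneg_left (hCw w hw x hx) (by positivity)
    _ = (B + 1) * C * w x := by ring

theorem cMu_mul_rpow_le_integral {N : ℕ} (hN : 3 ≤ N) {μ k : ℝ} {f u : Euc N → ℝ}
    (hfnn : ∀ x : Euc N, x ≠ 0 → 0 ≤ f x)
    (hid : ∀ ξ : Euc N → ℝ, IsC11c ξ →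
      ∫ x : Euc N, u x * LstarMu N μ ξ x * ‖x‖ ^ tauPlus N μ =
        (∫ x : Euc N, f x * ξ x * ‖x‖ ^ tauPlus N μ) + cMu N μ * k * ξ 0) {r : ℝ} (hr : 0 < r) :
    cMu N μ * k * r ^ tauMinus N μ ≤
      ∫ y : Euc N, u (r • y) * cutoffAdjoint N μ ‖y‖ * ‖y‖ ^ tauPlus N μ := by
  have h := hid _ (isC11c_cutoff hr)
  have hf : 0 ≤ ∫ x : Euc N, f x * cutoff (‖r⁻¹ • x‖ ^ 2) * ‖x‖ ^ tauPlus N μ := by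
    have : Nonempty (Fin N) := ⟨⟨0, by omega⟩⟩
    refine integral_nonneg_of_ae ?_
    filter_upwards [Measure.ae_ne volume 0] with x hx
    exact mul_nonneg (mul_nonneg (hfnn x hx) (cutoff_nonneg _))
      (Real.rpow_nonneg (norm_nonneg x) _)
  have hL : ∀ x, LstarMu N μ (fun x : Euc N => cutoff (‖r⁻¹ • x‖ ^ 2)) x =
      (r⁻¹) ^ 2 * cutoffAdjoint N μ ‖r⁻¹ • x‖ := fun x => by
    rw [lstarMu_comp_smul (inv_ne_zero hr.ne') fun y : Euc N => cutoff (‖y‖ ^ 2), lstarMu_cutoff]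
  have hs := Measure.integral_comp_smul_of_nonneg (volume : Measure (Euc N))
    (fun x => u x * ((r⁻¹) ^ 2 * cutoffAdjoint N μ ‖r⁻¹ • x‖) * ‖x‖ ^ tauPlus N μ) r (hR := hr.le)
  have hpow : r ^ N * (r⁻¹ ^ 2 * r ^ tauPlus N μ) * r ^ tauMinus N μ = 1 := by
    rw [inv_pow, ← Real.rpow_natCast, ← Real.rpow_natCast, ← Real.rpow_neg hr.le,
      ← Real.rpow_add hr, ← Real.rpow_add hr, ← Real.rpow_add hr, tauPlus, tauMinus]
    convert Real.rpow_zero r using 2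
    push_cast
    ring
  have hc : ∀ y : Euc N, u (r • y) * (r⁻¹ ^ 2 * cutoffAdjoint N μ ‖r⁻¹ • r • y‖) *
      ‖r • y‖ ^ tauPlus N μ = (r⁻¹ ^ 2 * r ^ tauPlus N μ) *
        (u (r • y) * cutoffAdjoint N μ ‖y‖ * ‖y‖ ^ tauPlus N μ) := fun y => by
    rw [inv_smul_smul₀ hr.ne', norm_smul, Real.norm_of_nonneg hr.le,
      Real.mul_rpow hr.le (norm_nonneg y)]
    ring
  simp only [hL, smul_zero, norm_zero] at h
  rw [cutoff_of_le_one (by norm_num)] at h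
  simp only [hc, integral_const_mul, h, finrank_euclideanSpace_fin, smul_eq_mul] at hs
  have hrN : 0 < r ^ N := pow_pos hr N
  have hτ : 0 < r ^ tauMinus N μ := Real.rpow_pos_of_pos hr _
  rw [eq_inv_mul_iff_mul_eq₀ hrN.ne'] at hs
  have hle : cMu N μ * k ≤ r ^ N * (r⁻¹ ^ 2 * r ^ tauPlus N μ *
      ∫ y : Euc N, u (r • y) * cutoffAdjoint N μ ‖y‖ * ‖y‖ ^ tauPlus N μ) := by linarith
  refine (mul_le_mul_of_nonneg_right hle hτ.le).trans_eq ?_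
  linear_combination (∫ y : Euc N, u (r • y) * cutoffAdjoint N μ ‖y‖ * ‖y‖ ^ tauPlus N μ) * hpow

/-- A multiple of the gap between `k` and `a` can be added to `a` in a lower bound
`a * ‖x‖ ^ tauMinus N μ ≤ u x`. -/
theorem exists_forall_improve_lower_bound {N : ℕ} (hN : 3 ≤ N) {μ : ℝ} (hμ : μ < mu0 N) {k : ℝ}
    {f u : Euc N → ℝ} (hfnn : ∀ x : Euc N, x ≠ 0 → 0 ≤ f x)
    (hu : IsNonnegSupersolution N μ u)
    (hid : ∀ ξ : Euc N → ℝ, IsC11c ξ →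
      ∫ x : Euc N, u x * LstarMu N μ ξ x * ‖x‖ ^ tauPlus N μ =
        (∫ x : Euc N, f x * ξ x * ‖x‖ ^ tauPlus N μ) + cMu N μ * k * ξ 0) :
    ∃ c > 0, ∀ a : ℝ, (∀ x : Euc N, x ≠ 0 → a * ‖x‖ ^ tauMinus N μ ≤ u x) →
      ∀ x : Euc N, x ≠ 0 → (a + c * (k - a)) * ‖x‖ ^ tauMinus N μ ≤ u x := by
  obtain ⟨C, hC, hCw⟩ := exists_integral_mul_cutoffAdjoint_le hN μ
  refine ⟨cMu N μ / C, div_pos (cMu_pos hN hμ) hC, fun a ha x hx => ?_⟩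
  have hr : 0 < ‖x‖ := norm_pos_iff.2 hx
  set r := ‖x‖
  have hsub := isNonnegSupersolution_sub hμ hu hr ha
  have h1 := hCw _ hsub (r⁻¹ • x) (by
    rw [norm_smul, Real.norm_of_nonneg (by positivity), inv_mul_cancel₀ hr.ne'])
  have h2 := cMu_mul_rpow_le_integral hN hfnn hid hr
  have hcu : ContinuousOn (fun y : Euc N => u (r • y)) {y | y ≠ 0} :=
    hu.1.continuousOn.comp (by fun_prop) fun y hy => smul_ne_zero hr.ne' hy
  have hcv : ContinuousOn (fun y : Euc N => ‖y‖ ^ tauMinus N μ) {y | y ≠ 0} :=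
    continuous_norm.continuousOn.rpow_const fun y hy => Or.inl (norm_ne_zero_iff.2 hy)
  have h3 : ∫ y : Euc N, (u (r • y) - a * r ^ tauMinus N μ * ‖y‖ ^ tauMinus N μ) *
      cutoffAdjoint N μ ‖y‖ * ‖y‖ ^ tauPlus N μ =
      (∫ y : Euc N, u (r • y) * cutoffAdjoint N μ ‖y‖ * ‖y‖ ^ tauPlus N μ)
        - a * r ^ tauMinus N μ * cMu N μ := by
    rw [← integral_rpow_mul_cutoffAdjoint hN hμ, ← integral_const_mul,
      ← integral_sub (integrable_mul_cutoffAdjoint μ hcu)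
        ((integrable_mul_cutoffAdjoint μ hcv).const_mul _)]
    congr 1
    funext y
    ring
  have h4 : ‖r⁻¹ • x‖ = 1 := by
    rw [norm_smul, Real.norm_of_nonneg (by positivity), inv_mul_cancel₀ hr.ne']
  simp only [smul_inv_smul₀ hr.ne', h4, Real.one_rpow] at h1
  rw [h3] at h1
  have h5 : cMu N μ / C * ((k - a) * r ^ tauMinus N μ) ≤ u x - a * r ^ tauMinus N μ := by
    rw [div_mul_eq_mul_div, div_le_iff₀ hC]
    linarith
  linarith

/-- Lemma 2.5: a nonnegative solution satisfying the dμ-distributional identity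
with constant k dominates kΦ_μ. -/
theorem identity_solution_lower_bound
    (N : ℕ) (hN : 3 ≤ N) (μ : ℝ) (hμ : μ < mu0 N)
    (γ : ℝ) (hγ : 0 < γ ∧ γ < 1) (f : Euc N → ℝ)
    (hfnn : ∀ x : Euc N, x ≠ 0 → 0 ≤ f x)
    (hfreg : LocHolderOn γ {x : Euc N | x ≠ 0} f)
    (hfint : ∀ K : Set (Euc N), IsCompact K →
      ∫⁻ x in K, ENNReal.ofReal (f x * ‖x‖ ^ tauPlus N μ) < ⊤)
    (u : Euc N → ℝ) (k : ℝ) (hk : 0 ≤ k)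
    (hureg : ContDiffOn ℝ 2 u {x : Euc N | x ≠ 0})
    (hunn : ∀ x : Euc N, x ≠ 0 → 0 ≤ u x)
    (hueq : ∀ x : Euc N, x ≠ 0 → -lap u x - μ * ‖x‖ ^ (-2 : ℝ) * u x = f x)
    (huinf : Tendsto u (normAtTop N) (nhds 0))
    (hid : ∀ ξ : Euc N → ℝ, IsC11c ξ →
      ∫ x : Euc N, u x * LstarMu N μ ξ x * ‖x‖ ^ tauPlus N μ =
        (∫ x : Euc N, f x * ξ x * ‖x‖ ^ tauPlus N μ) + cMu N μ * k * ξ 0) :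
    ∀ x : Euc N, x ≠ 0 → k * ‖x‖ ^ tauMinus N μ ≤ u x := by
  have hu : IsNonnegSupersolution N μ u :=
    ⟨hureg, hunn, fun x hx => (hfnn x hx).trans_eq (hueq x hx).symm⟩
  obtain ⟨c, hc, himp⟩ := exists_forall_improve_lower_bound hN hμ hfnn hu hid
  set S : Set ℝ := {a | ∀ x : Euc N, x ≠ 0 → a * ‖x‖ ^ tauMinus N μ ≤ u x}
  have h0 : (0 : ℝ) ∈ S := fun x hx => by simpa using hunn x hx
  have hbdd : BddAbove S := by
    let e : Euc N := EuclideanSpace.single ⟨0, by omega⟩ 1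
    have he : ‖e‖ = 1 := by simp [e]
    refine ⟨u e, fun a ha => ?_⟩
    simpa [he] using ha e (norm_ne_zero_iff.1 (by rw [he]; exact one_ne_zero))
  have hmem : sSup S ∈ S := fun x hx => by
    have hpos : 0 < ‖x‖ ^ tauMinus N μ := Real.rpow_pos_of_pos (norm_pos_iff.2 hx) _
    rw [← le_div_iff₀ hpos]
    exact csSup_le ⟨0, h0⟩ fun a ha => (le_div_iff₀ hpos).2 (ha x hx)
  have hle : k ≤ sSup S := by
    by_contra! hlt
    have := le_csSup hbdd (himp _ hmem)
    nlinarith [mul_pos hc (sub_pos.2 hlt)]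
  exact fun x hx => (mul_le_mul_of_nonneg_right hle
    (Real.rpow_nonneg (norm_nonneg x) _)).trans (hmem x hx)
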